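/- Let d ≥ 1, s ∈ (0,1] and L > 0. If f : ℝ^d → ℝ is nonnegative, measurable, and satisfies |f(x) − f(y)| ≤ L‖x−y‖^s for all x, y ∈ ℝ^d, then for every x ∈ ℝ^d and every t > 0, |f_t(x) − f(x)| ≤ d L t^s / (s + d). -/

import Mathlib

open MeasureTheory Real

noncomputable section

abbrev Euc (d : ℕ) : Type := EuclideanSpace ℝ (Fin d)

/-- Volume of the unit Euclidean ball in `ℝ^d`. -/
def unitBallVol (d : ℕ) : ℝ := Real.pi ^ ((d : ℝ) / 2) / Real.Gamma (1 + (d : ℝ) / 2)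

/-- `f_t(x)`: the average of `f` over the closed Euclidean ball `B(x,t)`. -/
def ballAvg (d : ℕ) (f : Euc d → ℝ) (t : ℝ) (x : Euc d) : ℝ :=
  (1 / (unitBallVol d * t ^ d)) * ∫ u in Metric.closedBall x t, f u

end

noncomputable section

open Metric Set Module in
/-- The integral of `‖u - x‖ ^ s` over a ball centred at `x`, in polar coordinates. -/
theorem setIntegral_closedBall_norm_sub_rpow {E : Type*} [NormedAddCommGroup E]
    [NormedSpace ℝ E] [Nontrivial E] [FiniteDimensional ℝ E] [MeasurableSpace E] [BorelSpace E]
    (μ : Measure E) [μ.IsAddHaarMeasure] {s t : ℝ} (hs : 0 ≤ s) (ht : 0 ≤ t) (x : E) :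
    ∫ u in closedBall x t, ‖u - x‖ ^ s ∂μ =
      finrank ℝ E * μ.real (ball 0 1) * (t ^ (s + finrank ℝ E) / (s + finrank ℝ E)) := by
  have hd : 1 ≤ finrank ℝ E := finrank_pos
  calc
    _ = ∫ u, (Iic t).indicator (· ^ s) ‖u - x‖ ∂μ := by
      rw [← integral_indicator measurableSet_closedBall]
      simp [indicator, dist_eq_norm]
    _ = ∫ u, (Iic t).indicator (· ^ s) ‖u‖ ∂μ :=
      integral_sub_right_eq_self (fun u : E => (Iic t).indicator (· ^ s) ‖u‖) x
    _ = finrank ℝ E * μ.real (ball 0 1) *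
        ∫ y in Ioi (0 : ℝ), y ^ (finrank ℝ E - 1) * (Iic t).indicator (· ^ s) y := by
      rw [integral_fun_norm_addHaar μ ((Iic t).indicator (· ^ s))]
      simp [mul_assoc]
    _ = finrank ℝ E * μ.real (ball 0 1) *
        ∫ y in Ioi (0 : ℝ), (Iic t).indicator (· ^ (s + finrank ℝ E - 1)) y := by
      congr 1
      refine setIntegral_congr_fun measurableSet_Ioi fun y (hy : 0 < y) => ?_
      by_cases h : y ≤ t
      · simp only [indicator, mem_Iic, h, if_true]
        rw [← rpow_natCast, ← rpow_add hy, Nat.cast_sub hd]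
        congr 1
        push_cast
        ring
      · simp [h]
    _ = _ := by
      congr 1
      have hd' : (1 : ℝ) ≤ finrank ℝ E := by exact_mod_cast hd
      rw [setIntegral_indicator measurableSet_Iic, Ioi_inter_Iic,
        ← intervalIntegral.integral_of_le ht, integral_rpow (Or.inl (by linarith)),
        sub_add_cancel, zero_rpow (by linarith), sub_zero]

theorem unitBallVol_pos (d : ℕ) : 0 < unitBallVol d := by
  have := Gamma_pos_of_pos (show 0 < 1 + (d : ℝ) / 2 by positivity)
  unfold unitBallVol
  positivity

theorem volume_real_closedBall_eq_unitBallVol_mul {d : ℕ} (hd : 1 ≤ d) (x : Euc d) {t : ℝ}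
    (ht : 0 ≤ t) : volume.real (Metric.closedBall x t) = unitBallVol d * t ^ d := by
  have : Nonempty (Fin d) := ⟨⟨0, hd⟩⟩
  have hpow : √π ^ d = π ^ ((d : ℝ) / 2) := by
    rw [sqrt_eq_rpow, ← rpow_natCast, ← rpow_mul pi_pos.le]
    congr 1
    ring
  have hvol : √π ^ d / Gamma ((d : ℝ) / 2 + 1) = unitBallVol d := by
    rw [hpow, unitBallVol, add_comm]
  rw [measureReal_def, EuclideanSpace.volume_closedBall, Fintype.card_fin, hvol,
    ENNReal.toReal_mul, ENNReal.toReal_pow, ENNReal.toReal_ofReal ht,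
    ENNReal.toReal_ofReal (unitBallVol_pos d).le, mul_comm]

theorem continuous_of_abs_sub_le_mul_rpow {E : Type*} [SeminormedAddCommGroup E] {f : E → ℝ}
    {s L : ℝ} (hs : 0 < s) (h : ∀ x y, |f x - f y| ≤ L * ‖x - y‖ ^ s) : Continuous f := by
  refine continuous_iff_continuousAt.2 fun x => ?_
  refine tendsto_iff_norm_sub_tendsto_zero.2 (squeeze_zero (fun _ => norm_nonneg _)
    (fun y => h y x) ?_)
  have : Continuous fun y => L * ‖y - x‖ ^ s := by fun_prop (disch := simp [hs.le])
  simpa [hs.ne'] using this.tendsto x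

/-- For a nonnegative `(s,L)`-Hölder function with `s ∈ (0,1]`,
the ball average `f_t` satisfies `|f_t(x) - f(x)| ≤ d L t^s/(s+d)`. -/
theorem ballAvg_sub_self_le_of_holder (d : ℕ) (hd : 1 ≤ d) (s L : ℝ)
    (hs : 0 < s) (hs1 : s ≤ 1) (hL : 0 < L)
    (f : Euc d → ℝ) (hmeas : Measurable f) (hnonneg : ∀ x, 0 ≤ f x)
    (hHolder : ∀ x y : Euc d, |f x - f y| ≤ L * ‖x - y‖ ^ s)
    (x : Euc d) (t : ℝ) (ht : 0 < t) :
    |ballAvg d f t x - f x| ≤ d * L * t ^ s / (s + d) := by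
  have : Nonempty (Fin d) := ⟨⟨0, hd⟩⟩
  have hV := unitBallVol_pos d
  have hfc : Continuous f := continuous_of_abs_sub_le_mul_rpow hs hHolder
  have hK := isCompact_closedBall x t
  have hc : 0 < unitBallVol d * t ^ d := by positivity
  have hball : volume.real (Metric.ball (0 : Euc d) 1) = unitBallVol d := by
    rw [measureReal_def, ← Measure.addHaar_closedBall_eq_addHaar_ball, ← measureReal_def,
      volume_real_closedBall_eq_unitBallVol_mul hd _ zero_le_one, one_pow, mul_one]
  have hsub : ballAvg d f t x - f x =
      (1 / (unitBallVol d * t ^ d)) * ∫ u in Metric.closedBall x t, (f u - f x) := by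
    rw [integral_sub (hfc.continuousOn.integrableOn_compact hK)
      (continuousOn_const.integrableOn_compact hK), setIntegral_const,
      volume_real_closedBall_eq_unitBallVol_mul hd x ht.le, ballAvg, smul_eq_mul]
    field_simp
  have hbound : |∫ u in Metric.closedBall x t, (f u - f x)| ≤
      ∫ u in Metric.closedBall x t, L * ‖u - x‖ ^ s := by
    have hg : Continuous fun u => L * ‖u - x‖ ^ s := by fun_prop (disch := simp [hs.le])
    rw [← norm_eq_abs]
    exact norm_integral_le_of_norm_le (hg.continuousOn.integrableOn_compact hK)
      (Filter.Eventually.of_forall fun u => hHolder u x)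
  rw [integral_const_mul, setIntegral_closedBall_norm_sub_rpow volume hs.le ht.le, hball,
    finrank_euclideanSpace_fin, rpow_add ht, rpow_natCast] at hbound
  rw [hsub, abs_mul, abs_of_pos (one_div_pos.2 hc)]
  calc
    _ ≤ 1 / (unitBallVol d * t ^ d) *
        (L * (d * unitBallVol d * (t ^ s * t ^ d / (s + d)))) := by gcongr
    _ = d * L * t ^ s / (s + d) := by field_simp

end
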